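/- arXiv:math/0005168 — 2 statements merged into one kernel-verified Lean document; each statement's English description precedes it below -/
import Mathlib

section
/- Let H be a complex Hilbert space with dim H ≥ 3 and let B_s(H) denote the set of all bounded self-adjoint operators on H. If φ : B_s(H) → B_s(H) is a bijective map (linearity not assumed) satisfying φ(ABA) = φ(A)φ(B)φ(A) for all A, B ∈ B_s(H), then there exists an operator U on H, either unitary or antiunitary, such that either φ(A) = U A U* for all A ∈ B_s(H), or φ(A) = −U A U* for all A ∈ B_s(H). -/
open InnerProductSpace ContinuousLinearMap

set_option linter.unusedSectionVars false

namespace JTM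

variable {H : Type*} [NormedAddCommGroup H] [InnerProductSpace ℂ H] [CompleteSpace H]

/-- Rank one operator `x ⊗ x`. -/
noncomputable def pr (x : H) : H →L[ℂ] H := rankOne ℂ x x

theorem mula (A B : H →L[ℂ] H) (x : H) : (A * B) x = A (B x) := rfl

theorem onea (x : H) : (1 : H →L[ℂ] H) x = x := rfl

theorem pr_apply (x z : H) : pr x z = inner ℂ x z • x := rfl

theorem star_rankOne (x y : H) : star (rankOne ℂ x y) = rankOne ℂ y x := by
  rw [star_eq_adjoint]; simp

theorem pr_sa (x : H) : IsSelfAdjoint (pr x) := by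
  rw [IsSelfAdjoint, pr, star_rankOne]

theorem pr_idem {x : H} (hx : ‖x‖ = 1) : pr x * pr x = pr x := by
  ext z
  simp [pr_apply, hx]

theorem pr_mul_mul (x : H) (A : H →L[ℂ] H) :
    pr x * A * pr x = (inner ℂ x (A x)) • pr x := by
  ext z
  simp [pr_apply, smul_smul, mul_comm]

theorem pr_ne_zero {x : H} (hx : x ≠ 0) : pr x ≠ 0 := rankOne_ne_zero hx hx

theorem ne_zero_of_unit {x : H} (hx : ‖x‖ = 1) : x ≠ 0 := by
  rintro rfl; simp at hx

theorem inner_sa_real {A : H →L[ℂ] H} (hA : IsSelfAdjoint A) (x : H) :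
    (((inner ℂ x (A x)).re : ℝ) : ℂ) = inner ℂ x (A x) := by
  have h : (starRingEnd ℂ) (inner ℂ x (A x)) = inner ℂ x (A x) := by
    rw [inner_conj_symm, ← ContinuousLinearMap.adjoint_inner_right]
    rw [← star_eq_adjoint, hA.star_eq]
  exact Complex.conj_eq_iff_re.mp h

/-- A bounded operator commuting with all rank one projections is scalar. -/
theorem scalar_of_commute (B : H →L[ℂ] H)
    (h : ∀ x : H, ‖x‖ = 1 → B * pr x = pr x * B) : ∃ c : ℂ, B = c • (1 : H →L[ℂ] H) := by
  have h1 : ∀ x : H, ∃ c : ℂ, B x = c • x := by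
    intro x
    by_cases hx : x = 0
    · exact ⟨0, by simp [hx]⟩
    have hn : (‖x‖ : ℂ) ≠ 0 := by simpa using hx
    set u : H := ((‖x‖ : ℂ)⁻¹) • x with hu
    have hun : ‖u‖ = 1 := by
      rw [hu, norm_smul]; simp [hx]
    have h2 := congrArg (fun T : H →L[ℂ] H => T u) (h u hun)
    simp only [mula, pr_apply] at h2
    have h3 : inner ℂ u u = (1 : ℂ) := by
      rw [inner_self_eq_norm_sq_to_K, hun]; simp
    rw [h3, one_smul] at h2
    refine ⟨inner ℂ u (B u), ?_⟩
    have hxu : x = (‖x‖ : ℂ) • u := by rw [hu, smul_smul, mul_inv_cancel₀ hn, one_smul]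
    calc B x = B ((‖x‖ : ℂ) • u) := by rw [← hxu]
      _ = (‖x‖ : ℂ) • (inner ℂ u (B u) • u) := by rw [map_smul, ← h2]
      _ = inner ℂ u (B u) • x := by rw [smul_comm, ← hxu]
  rcases subsingleton_or_nontrivial H with hs | hs
  · exact ⟨0, by ext x; exact Subsingleton.elim _ _⟩
  obtain ⟨e, he⟩ := exists_ne (0 : H)
  obtain ⟨c, hc⟩ := h1 e
  refine ⟨c, ?_⟩
  ext x
  simp only [smul_apply, onea]
  by_cases hli : LinearIndependent ℂ ![e, x]
  · obtain ⟨d, hd⟩ := h1 x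
    obtain ⟨k, hk⟩ := h1 (e + x)
    rw [map_add, hc, hd] at hk
    rw [LinearIndependent.pair_iff] at hli
    have := hli (c - k) (d - k) (by
      rw [sub_smul, sub_smul]
      have : c • e + d • x - k • (e + x) = 0 := sub_eq_zero.mpr hk
      rw [← this, smul_add]; abel)
    rw [hd, show d = c by linear_combination this.2 - this.1]
  · rw [LinearIndependent.pair_iff' he] at hli
    push Not at hli
    obtain ⟨a, rfl⟩ := hli
    rw [map_smul, hc, smul_comm]

theorem sa_idem_mul_zero {p q : H →L[ℂ] H} (hp : IsSelfAdjoint p) (hq : IsSelfAdjoint q)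
    (hqi : q * q = q) (h : p * q * p = 0) : p * q = 0 := by
  have : (p * q) * star (p * q) = 0 := by
    rw [star_mul, hp.star_eq, hq.star_eq, ← mul_assoc, mul_assoc p q q, hqi, h]
  exact CStarRing.mul_star_self_eq_zero_iff _ |>.mp this

theorem le_mul {p q : H →L[ℂ] H} (hq : q * q = q) (h : q * p * q = p) :
    q * p = p ∧ p * q = p := by
  constructor
  · rw [← h, mul_assoc, ← mul_assoc q q, hq]
  · rw [← h, mul_assoc, hq]

/-- self-adjoint idempotents -/
def Pj (p : H →L[ℂ] H) : Prop := IsSelfAdjoint p ∧ p * p = p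

/-- atoms -/
def At (q : H →L[ℂ] H) : Prop :=
  Pj q ∧ q ≠ 0 ∧ ∀ r, Pj r → q * r * q = r → r = 0 ∨ r = q

theorem pr_Pj {x : H} (hx : ‖x‖ = 1) : Pj (pr x) := ⟨pr_sa x, pr_idem hx⟩

theorem at_pr {x : H} (hx : ‖x‖ = 1) : At (pr x) := by
  refine ⟨pr_Pj hx, pr_ne_zero (ne_zero_of_unit hx), ?_⟩
  intro r hr h
  rw [pr_mul_mul] at h
  set c := inner ℂ x (r x) with hc
  have h2 := hr.2
  rw [← h, smul_mul_smul_comm, pr_idem hx] at h2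
  have h3 : (c * c - c) • pr x = 0 := by rw [sub_smul, h2, sub_self]
  rcases smul_eq_zero.mp h3 with h4 | h4
  · have : c * (c - 1) = 0 := by linear_combination h4
    rcases mul_eq_zero.mp this with h5 | h5
    · left; rw [← h, h5, zero_smul]
    · right; rw [← h, sub_eq_zero.mp h5, one_smul]
  · exact absurd h4 (pr_ne_zero (ne_zero_of_unit hx))

theorem at_iff {q : H →L[ℂ] H} (hq : At q) : ∃ x : H, ‖x‖ = 1 ∧ q = pr x := by
  obtain ⟨⟨hsa, hid⟩, hne, hmin⟩ := hq
  obtain ⟨z, hz⟩ : ∃ z, q z ≠ 0 := by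
    by_contra! hcon
    exact hne (by ext z; simp [hcon z])
  set x : H := ((‖q z‖ : ℂ)⁻¹) • q z with hx
  have hxn : ‖x‖ = 1 := by rw [hx, norm_smul]; simp [hz]
  have hqx : q x = x := by
    rw [hx, map_smul, ← mula, hid]
  refine ⟨x, hxn, ?_⟩
  have h1 : q * pr x * q = pr x := by
    ext w
    simp only [mula, pr_apply, map_smul, hqx]
    rw [← ContinuousLinearMap.adjoint_inner_left, ← star_eq_adjoint, hsa.star_eq, hqx]
  rcases hmin _ (pr_Pj hxn) h1 with h | h
  · exact absurd h (pr_ne_zero (ne_zero_of_unit hxn))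
  · exact h.symm

/-- Normalised Jordan triple bijections. -/
structure JT (φ : (H →L[ℂ] H) → (H →L[ℂ] H)) : Prop where
  sa : ∀ A, IsSelfAdjoint A → IsSelfAdjoint (φ A)
  inj : ∀ A B, IsSelfAdjoint A → IsSelfAdjoint B → φ A = φ B → A = B
  surj : ∀ B, IsSelfAdjoint B → ∃ A, IsSelfAdjoint A ∧ φ A = B
  triple : ∀ A B, IsSelfAdjoint A → IsSelfAdjoint B → φ (A * B * A) = φ A * φ B * φ A
  one : φ 1 = 1

theorem sa_triple {A B : H →L[ℂ] H} (hA : IsSelfAdjoint A) (hB : IsSelfAdjoint B) :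
    IsSelfAdjoint (A * B * A) := by
  rw [IsSelfAdjoint, star_mul, star_mul, hA.star_eq, hB.star_eq, mul_assoc]

theorem sa_one : IsSelfAdjoint (1 : H →L[ℂ] H) := IsSelfAdjoint.one _

theorem sa_smul (t : ℝ) {A : H →L[ℂ] H} (hA : IsSelfAdjoint A) :
    IsSelfAdjoint ((t : ℂ) • A) := by
  rw [IsSelfAdjoint, star_smul, hA.star_eq]; simp

namespace JT

variable {φ : (H →L[ℂ] H) → (H →L[ℂ] H)}

theorem zero (hφ : JT φ) : φ 0 = 0 := by
  obtain ⟨B, hB, h⟩ := hφ.surj 0 (IsSelfAdjoint.zero _)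
  have := hφ.triple 0 B (IsSelfAdjoint.zero _) hB
  rw [h] at this
  simpa using this

theorem sq (hφ : JT φ) (A : H →L[ℂ] H) (hA : IsSelfAdjoint A) : φ (A * A) = φ A * φ A := by
  have := hφ.triple A 1 hA sa_one
  rwa [hφ.one, mul_one, mul_one] at this

theorem pj_iff (hφ : JT φ) {A : H →L[ℂ] H} (hA : IsSelfAdjoint A) : Pj (φ A) ↔ Pj A := by
  constructor
  · rintro ⟨_, h⟩
    refine ⟨hA, ?_⟩
    rw [← hφ.sq A hA] at h
    exact hφ.inj _ _ (by rw [IsSelfAdjoint, star_mul, hA.star_eq]) hA h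
  · rintro ⟨_, h⟩
    exact ⟨hφ.sa A hA, by rw [← hφ.sq A hA, h]⟩

theorem pj_surj (hφ : JT φ) {q : H →L[ℂ] H} (hq : Pj q) : ∃ p, Pj p ∧ φ p = q := by
  obtain ⟨p, hp, rfl⟩ := hφ.surj q hq.1
  exact ⟨p, (hφ.pj_iff hp).mp hq, rfl⟩

theorem le_iff (hφ : JT φ) {p q : H →L[ℂ] H} (hp : IsSelfAdjoint p) (hq : IsSelfAdjoint q) :
    φ q * φ p * φ q = φ p ↔ q * p * q = p := by
  rw [← hφ.triple q p hq hp]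
  exact ⟨fun h => hφ.inj _ _ (sa_triple hq hp) hp h, fun h => by rw [h]⟩

theorem eq_zero_iff (hφ : JT φ) {A : H →L[ℂ] H} (hA : IsSelfAdjoint A) : φ A = 0 ↔ A = 0 := by
  constructor
  · intro h
    exact hφ.inj _ _ hA (IsSelfAdjoint.zero _) (by rw [h, hφ.zero])
  · rintro rfl; exact hφ.zero

theorem at_map (hφ : JT φ) {q : H →L[ℂ] H} (hq : At q) : At (φ q) := by
  obtain ⟨hpj, hne, hmin⟩ := hq
  refine ⟨(hφ.pj_iff hpj.1).mpr hpj, fun h => hne ((hφ.eq_zero_iff hpj.1).mp h), ?_⟩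
  intro r hr h
  obtain ⟨s, hs, rfl⟩ := hφ.pj_surj hr
  rw [hφ.le_iff hs.1 hpj.1] at h
  rcases hmin s hs h with h | h
  · left; rw [h, hφ.zero]
  · right; rw [h]

theorem at_comap (hφ : JT φ) {q : H →L[ℂ] H} (hsa : IsSelfAdjoint q) (hq : At (φ q)) : At q := by
  obtain ⟨hpj, hne, hmin⟩ := hq
  refine ⟨(hφ.pj_iff hsa).mp hpj, fun h => hne ((hφ.eq_zero_iff hsa).mpr h), ?_⟩
  intro r hr h
  rw [← hφ.le_iff hr.1 hsa] at h
  rcases hmin _ ((hφ.pj_iff hr.1).mpr hr) h with h | h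
  · left; exact (hφ.eq_zero_iff hr.1).mp h
  · right; exact hφ.inj _ _ hr.1 hsa h

theorem pr_map (hφ : JT φ) {x : H} (hx : ‖x‖ = 1) : ∃ y : H, ‖y‖ = 1 ∧ φ (pr x) = pr y :=
  at_iff (hφ.at_map (at_pr hx))

theorem pr_comap (hφ : JT φ) {y : H} (hy : ‖y‖ = 1) : ∃ x : H, ‖x‖ = 1 ∧ φ (pr x) = pr y := by
  obtain ⟨q, hq, h⟩ := hφ.surj (pr y) (pr_sa y)
  have : At q := hφ.at_comap hq (by rw [h]; exact at_pr hy)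
  obtain ⟨x, hx, rfl⟩ := at_iff this
  exact ⟨x, hx, h⟩

theorem orth (hφ : JT φ) {p q : H →L[ℂ] H} (hp : Pj p) (hq : Pj q) (h : p * q = 0) : φ p * φ q = 0 := by
  apply sa_idem_mul_zero (hφ.sa _ hp.1) (hφ.sa _ hq.1) ((hφ.pj_iff hq.1).mpr hq).2
  rw [← hφ.triple p q hp.1 hq.1, h, zero_mul, hφ.zero]

theorem _root_.JTM.pj_comm {p q : H →L[ℂ] H} (hp : Pj p) (hq : Pj q) (h : p * q = 0) :
    q * p = 0 := by
  have := congrArg star h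
  rwa [star_mul, hp.1.star_eq, hq.1.star_eq, star_zero] at this

theorem _root_.JTM.pj_add {p q : H →L[ℂ] H} (hp : Pj p) (hq : Pj q) (h : p * q = 0) :
    Pj (p + q) := by
  refine ⟨hp.1.add hq.1, ?_⟩
  rw [mul_add, add_mul, add_mul, hp.2, hq.2, h, pj_comm hp hq h]; simp

theorem add_pj (hφ : JT φ) {p q : H →L[ℂ] H} (hp : Pj p) (hq : Pj q) (h : p * q = 0) :
    φ (p + q) = φ p + φ q := by
  have hp' := (hφ.pj_iff hp.1).mpr hp
  have hq' := (hφ.pj_iff hq.1).mpr hq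
  have h' := hφ.orth hp hq h
  have hc := pj_comm hp hq h
  have hc' := pj_comm hp' hq' h'
  have hs := pj_add hp hq h
  have hs' := pj_add hp' hq' h'
  have hss := (hφ.pj_iff hs.1).mpr hs
  obtain ⟨s, hsP, hsr⟩ := hφ.pj_surj hs'
  have a1 : s * p * s = p := by
    rw [← hφ.le_iff hp.1 hsP.1, hsr]
    rw [add_mul, hp'.2, hc', add_zero, mul_add, hp'.2, h', add_zero]
  have a2 : s * q * s = q := by
    rw [← hφ.le_iff hq.1 hsP.1, hsr]
    rw [add_mul, hq'.2, h', zero_add, mul_add, hq'.2, hc', zero_add]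
  have a3 : s * (p + q) * s = p + q := by rw [mul_add, add_mul, a1, a2]
  rw [← hφ.le_iff hs.1 hsP.1, hsr] at a3
  have b1 : (p + q) * p * (p + q) = p := by
    rw [add_mul, hp.2, hc, add_zero, mul_add, hp.2, h, add_zero]
  have b2 : (p + q) * q * (p + q) = q := by
    rw [add_mul, hq.2, h, zero_add, mul_add, hq.2, hc, zero_add]
  rw [← hφ.le_iff hp.1 hs.1] at b1
  rw [← hφ.le_iff hq.1 hs.1] at b2
  have b3 : φ (p + q) * (φ p + φ q) * φ (p + q) = φ p + φ q := by rw [mul_add, add_mul, b1, b2]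
  rw [← (le_mul hs'.2 a3).1, (le_mul hss.2 b3).2]

/-- Scalars are mapped to scalars. -/
theorem scalar (hφ : JT φ) (t : ℝ) : ∃ s : ℝ, φ ((t : ℂ) • 1) = (s : ℂ) • 1 := by
  have hsa : IsSelfAdjoint ((t : ℂ) • (1 : H →L[ℂ] H)) := sa_smul t sa_one
  set B := φ ((t : ℂ) • 1) with hB
  have hBsa : IsSelfAdjoint B := hφ.sa _ hsa
  have key : ∀ y : H, ‖y‖ = 1 → B * pr y = pr y * B := by
    intro y hy
    obtain ⟨P, hP, hPy⟩ := hφ.pj_surj (pr_Pj hy)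
    have hid := pr_idem hy
    set p := pr y with hp
    have h1 : φ (((t : ℂ) • 1) * P * ((t : ℂ) • 1)) = B * p * B := by
      rw [hφ.triple _ _ hsa hP.1, hPy]
    have h2 : φ (P * (((t : ℂ) • 1) * ((t : ℂ) • 1)) * P) = p * (B * B) * p := by
      rw [hφ.triple _ _ hP.1 ?_, hPy, hφ.sq _ hsa]
      rw [IsSelfAdjoint, star_mul, hsa.star_eq]
    have h3 : ((t : ℂ) • 1) * P * ((t : ℂ) • 1) = P * (((t : ℂ) • 1) * ((t : ℂ) • 1)) * P := by
      simp [smul_smul, hP.2]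
    rw [h3, h2] at h1
    have h4 : (B * p - p * B * p) * star (B * p - p * B * p) = 0 := by
      rw [star_sub, star_mul, star_mul, star_mul, hBsa.star_eq, (pr_sa y).star_eq]
      have e1 : (B * p - p * B * p) * (p * B - p * (B * p)) =
        B * (p * p) * B - B * (p * p) * B * p - p * (B * (p * p) * B)
          + p * (B * (p * p) * B) * p := by noncomm_ring
      rw [e1, hid, ← h1]
      have e2 : p * (B * B) * p * p = p * (B * B) * (p * p) := by noncomm_ring
      have e3 : p * (p * (B * B) * p) = (p * p) * (B * B) * p := by noncomm_ring
      rw [e2, e3, hid, e2, hid]; abel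
    have h5 := sub_eq_zero.mp ((CStarRing.mul_star_self_eq_zero_iff _).mp h4)
    have h6 := congrArg star h5
    rw [star_mul, star_mul, star_mul, hBsa.star_eq, (pr_sa y).star_eq] at h6
    rw [h5, mul_assoc]
    exact h6.symm
  obtain ⟨c, hc⟩ := scalar_of_commute B key
  rcases subsingleton_or_nontrivial H with hs | hs
  · exact ⟨0, by ext x; exact Subsingleton.elim _ _⟩
  have : star c = c := by
    have h := hBsa.star_eq
    rw [hc, star_smul, star_one] at h
    have h' : (star c - c) • (1 : H →L[ℂ] H) = 0 := by rw [sub_smul, h, sub_self]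
    rcases smul_eq_zero.mp h' with h | h
    · exact sub_eq_zero.mp h
    · exact absurd h one_ne_zero
  refine ⟨c.re, ?_⟩
  rw [hc, Complex.conj_eq_iff_re.mp this]

end JT
theorem f_id (f : ℝ → ℝ) (h0 : f 0 = 0) (h1 : f 1 = 1) (hinj : Function.Injective f)
    (hm : ∀ t s, f (t * t * s) = f t * f t * f s)
    (ha : ∀ a b c, 0 ≤ a → 0 ≤ b → 0 ≤ c → a + b + c = 1 → f a + f b + f c = 1) :
    ∀ t, f t = t := by
  have hsq : ∀ t, f (t * t) = f t * f t := by
    intro t; have := hm t 1; rwa [mul_one, h1, mul_one] at this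
  have hmul : ∀ s t, 0 ≤ s → f (s * t) = f s * f t := by
    intro s t hs
    have h := hm (Real.sqrt s) t
    rw [← hsq, Real.mul_self_sqrt hs] at h
    exact h
  have hneg1 : f (-1) = -1 := by
    have h := hsq (-1)
    rw [show (-1 : ℝ) * -1 = 1 by norm_num, h1] at h
    have h' : (f (-1) - 1) * (f (-1) + 1) = 0 := by linear_combination -h
    rcases mul_eq_zero.mp h' with h | h
    · have := hinj (show f (-1) = f 1 by rw [h1]; linarith)
      norm_num at this
    · linarith
  have hodd : ∀ t, f (-t) = - f t := by
    intro t
    rcases le_total 0 t with ht | ht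
    · have := hmul t (-1) ht
      rw [hneg1] at this
      rw [show -t = t * -1 by ring, this]; ring
    · have := hmul (-t) (-1) (by linarith)
      rw [hneg1, show -t * -1 = t by ring] at this
      rw [this]; ring
  have hadd1 : ∀ a b, 0 ≤ a → 0 ≤ b → a + b ≤ 1 → f (a + b) = f a + f b := by
    intro a b h h' h''
    have e1 := ha a b (1 - a - b) h h' (by linarith) (by ring)
    have e2 := ha (a + b) 0 (1 - a - b) (by linarith) le_rfl (by linarith) (by ring)
    rw [h0] at e2; linarith
  have hadd2 : ∀ a b, 0 ≤ a → 0 ≤ b → f (a + b) = f a + f b := by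
    intro a b h h'
    rcases eq_or_lt_of_le (show 0 ≤ a + b by linarith) with hz | hz
    · have : a = 0 := by linarith
      have : b = 0 := by linarith
      subst_vars; simp [h0]
    · have hp := hadd1 (a / (a + b)) (b / (a + b)) (by positivity) (by positivity)
        (by rw [← add_div, div_self hz.ne'])
      have e1 := hmul (a + b) (a / (a + b)) hz.le
      have e2 := hmul (a + b) (b / (a + b)) hz.le
      rw [mul_div_cancel₀ _ hz.ne'] at e1 e2
      rw [← add_div, div_self hz.ne', h1] at hp
      rw [e1, e2, ← mul_add, ← hp, mul_one]
  have hadd3 : ∀ a b, 0 ≤ a → f (a + b) = f a + f b := by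
    intro a b h
    rcases le_total 0 b with hb | hb
    · exact hadd2 a b h hb
    rcases le_total 0 (a + b) with hab | hab
    · have := hadd2 (a + b) (-b) hab (by linarith)
      rw [hodd, show a + b + -b = a by ring] at this
      linarith
    · have := hadd2 (-(a + b)) a (by linarith) h
      rw [hodd, show -(a + b) + a = -b by ring, hodd] at this
      linarith
  have hadd : ∀ a b, f (a + b) = f a + f b := by
    intro a b
    rcases le_total 0 a with h | h
    · exact hadd3 a b h
    · have := hadd3 (-a) (-b) (by linarith)
      rw [show -a + -b = -(a + b) by ring, hodd, hodd, hodd] at this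
      linarith
  have hmul' : ∀ a b, f (a * b) = f a * f b := by
    intro a b
    rcases le_total 0 a with h | h
    · exact hmul a b h
    · have := hmul (-a) b (by linarith)
      rw [show -a * b = -(a * b) by ring, hodd, hodd] at this
      linarith
  let F : ℝ →+* ℝ :=
    { toFun := f, map_one' := h1, map_mul' := hmul', map_zero' := h0, map_add' := hadd }
  intro t
  have : F = RingHom.id ℝ := Subsingleton.elim _ _
  exact congrArg (fun G : ℝ →+* ℝ => G t) this

theorem inner_self' (x : H) : inner ℂ x x = ((‖x‖ ^ 2 : ℝ) : ℂ) :=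
  (inner_self_eq_norm_sq_to_K x).trans (by push_cast; rfl)

theorem inner_unit {x : H} (hx : ‖x‖ = 1) : inner ℂ x x = (1 : ℂ) := by
  rw [inner_self_eq_norm_sq_to_K, hx]; simp

namespace JT

variable {φ : (H →L[ℂ] H) → (H →L[ℂ] H)}

theorem qf (hφ : JT φ) {f : ℝ → ℝ} (hf : ∀ t : ℝ, φ ((t : ℂ) • 1) = (f t : ℂ) • 1)
    {x y : H} (hx : ‖x‖ = 1) (hy : ‖y‖ = 1) (hxy : φ (pr x) = pr y)
    {A : H →L[ℂ] H} (hA : IsSelfAdjoint A) :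
    inner ℂ y (φ A y) = ((f (inner ℂ x (A x)).re : ℝ) : ℂ) := by
  have h1 := hφ.triple (pr x) A (pr_sa x) hA
  rw [pr_mul_mul, hxy, pr_mul_mul, ← inner_sa_real hA x] at h1
  have h2 := hφ.triple (pr x) (((inner ℂ x (A x)).re : ℂ) • 1) (pr_sa x) (sa_smul _ sa_one)
  rw [hf, hxy, mul_smul_comm, mul_one, smul_mul_assoc, pr_idem hx, h1, mul_smul_comm, mul_one,
    smul_mul_assoc, pr_idem hy] at h2
  exact smul_left_injective ℂ (pr_ne_zero (ne_zero_of_unit hy)) h2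

theorem f_props (hφ : JT φ) (v : Fin 3 → H) (hv : Orthonormal ℂ v) {f : ℝ → ℝ}
    (hf : ∀ t : ℝ, φ ((t : ℂ) • 1) = (f t : ℂ) • 1) : ∀ t, f t = t := by
  have hv1 : ∀ i, ‖v i‖ = 1 := hv.1
  have : Nontrivial H := ⟨v 0, 0, ne_zero_of_unit (hv1 0)⟩
  have hcancel : ∀ a b : ℝ, (a : ℂ) • (1 : H →L[ℂ] H) = (b : ℂ) • 1 → a = b := by
    intro a b h
    exact_mod_cast smul_left_injective ℂ (one_ne_zero (α := H →L[ℂ] H)) h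
  apply f_id
  · apply hcancel; rw [← hf]; simp [hφ.zero]
  · apply hcancel; rw [← hf]; simp [hφ.one]
  · intro a b hab
    apply hcancel
    apply hφ.inj _ _ (sa_smul _ sa_one) (sa_smul _ sa_one)
    rw [hf, hf, hab]
  · intro t s
    apply hcancel
    have := hφ.triple ((t : ℂ) • 1) ((s : ℂ) • 1) (sa_smul _ sa_one) (sa_smul _ sa_one)
    rw [hf, hf] at this
    rw [← hf]
    convert this using 2
    · simp only [smul_mul_smul_comm, mul_one]; congr 1; push_cast; ring
    · simp only [smul_mul_smul_comm, mul_one]; congr 1; push_cast; ring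
  · intro a b c ha hb hc habc
    set u : H := (Real.sqrt a : ℂ) • v 0 + (Real.sqrt b : ℂ) • v 1 + (Real.sqrt c : ℂ) • v 2 with hu
    have o := fun i j => (orthonormal_iff_ite.mp hv) i j
    have i0 : inner ℂ (v 0) u = (Real.sqrt a : ℂ) := by
      rw [hu, inner_add_right, inner_add_right, inner_smul_right, inner_smul_right,
        inner_smul_right, o, o, o]; simp
    have i1 : inner ℂ (v 1) u = (Real.sqrt b : ℂ) := by
      rw [hu, inner_add_right, inner_add_right, inner_smul_right, inner_smul_right,
        inner_smul_right, o, o, o]; simp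
    have i2 : inner ℂ (v 2) u = (Real.sqrt c : ℂ) := by
      rw [hu, inner_add_right, inner_add_right, inner_smul_right, inner_smul_right,
        inner_smul_right, o, o, o]; simp
    have sa' : ∀ r : ℝ, 0 ≤ r → (Real.sqrt r : ℂ) * Real.sqrt r = r := by
      intro r hr; rw [← Complex.ofReal_mul, Real.mul_self_sqrt hr]
    have huu : inner ℂ u u = (1 : ℂ) := by
      conv_lhs => rw [hu]
      rw [inner_add_left, inner_add_left, inner_smul_left, inner_smul_left, inner_smul_left,
        i0, i1, i2, Complex.conj_ofReal, Complex.conj_ofReal, Complex.conj_ofReal,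
        sa' a ha, sa' b hb, sa' c hc]
      exact_mod_cast habc
    have hun : ‖u‖ = 1 := by
      rw [inner_self'] at huu
      have : ‖u‖ ^ 2 = 1 := by
        exact_mod_cast huu
      nlinarith [norm_nonneg u]
    obtain ⟨w, hw, huw⟩ := hφ.pr_map hun
    have horth : ∀ i j, i ≠ j → pr (v i) * pr (v j) = 0 := by
      intro i j hij
      ext z
      simp [pr_apply, o, hij]
    have P := fun i => pr_Pj (hv1 i)
    have P01 := pj_add (P 0) (P 1) (horth 0 1 (by decide))
    have h012 : (pr (v 0) + pr (v 1)) * pr (v 2) = 0 := by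
      rw [add_mul, horth 0 2 (by decide), horth 1 2 (by decide), add_zero]
    have P012 := pj_add P01 (P 2) h012
    have hsum : φ (pr (v 0) + pr (v 1) + pr (v 2)) = φ (pr (v 0)) + φ (pr (v 1)) + φ (pr (v 2)) := by
      rw [hφ.add_pj P01 (P 2) h012, hφ.add_pj (P 0) (P 1) (horth 0 1 (by decide))]
    have hpu : (pr (v 0) + pr (v 1) + pr (v 2)) u = u := by
      simp only [add_apply, pr_apply, i0, i1, i2]; exact hu.symm
    have q := fun i => hφ.qf hf hun hw huw (P i).1
    have hq := hφ.qf hf hun hw huw P012.1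
    have hle : (pr (v 0) + pr (v 1) + pr (v 2)) * pr u * (pr (v 0) + pr (v 1) + pr (v 2)) = pr u := by
      set p := pr (v 0) + pr (v 1) + pr (v 2)
      ext z
      simp only [mula, pr_apply, map_smul, hpu]
      rw [← ContinuousLinearMap.adjoint_inner_left, ← star_eq_adjoint, P012.1.star_eq, hpu]
    rw [← hφ.le_iff (pr_sa u) P012.1, huw] at hle
    have hle2 := (le_mul ((hφ.pj_iff P012.1).mpr P012).2 hle).1
    have hle3 := congrArg (fun T : H →L[ℂ] H => T w) hle2
    simp only [mula, pr_apply, inner_unit hw, one_smul] at hle3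
    have hfin : inner ℂ w (φ (pr (v 0) + pr (v 1) + pr (v 2)) w) = (1 : ℂ) := by
      rw [hle3, inner_unit hw]
    rw [hsum] at hfin
    simp only [add_apply, inner_add_right, q, pr_apply, inner_smul_right] at hfin
    have j0 : inner ℂ u (v 0) = (Real.sqrt a : ℂ) := by
      rw [← inner_conj_symm, i0, Complex.conj_ofReal]
    have j1 : inner ℂ u (v 1) = (Real.sqrt b : ℂ) := by
      rw [← inner_conj_symm, i1, Complex.conj_ofReal]
    have j2 : inner ℂ u (v 2) = (Real.sqrt c : ℂ) := by
      rw [← inner_conj_symm, i2, Complex.conj_ofReal]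
    rw [i0, i1, i2, j0, j1, j2, sa' a ha, sa' b hb, sa' c hc] at hfin
    simp only [Complex.ofReal_re] at hfin
    exact_mod_cast hfin

theorem quad (hφ : JT φ) (v : Fin 3 → H) (hv : Orthonormal ℂ v) {x y : H} (hx : ‖x‖ = 1) (hy : ‖y‖ = 1)
    (hxy : φ (pr x) = pr y) {A : H →L[ℂ] H} (hA : IsSelfAdjoint A) :
    inner ℂ y (φ A y) = inner ℂ x (A x) := by
  choose f hf using hφ.scalar
  rw [hφ.qf hf hx hy hxy hA, hφ.f_props v hv hf, inner_sa_real hA]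

end JT

theorem ext_unit {A B : H →L[ℂ] H}
    (h : ∀ y : H, ‖y‖ = 1 → inner ℂ y (A y) = (inner ℂ y (B y) : ℂ)) : A = B := by
  have : (A : H →ₗ[ℂ] H) = (B : H →ₗ[ℂ] H) := by
    rw [← ext_inner_map]
    intro x
    by_cases hx : x = 0
    · simp [hx]
    have hn : (‖x‖ : ℂ) ≠ 0 := by simpa using hx
    set u : H := ((‖x‖ : ℂ)⁻¹) • x with hu
    have hun : ‖u‖ = 1 := by
      rw [hu, norm_smul]; simp [hx]
    have hxu : x = (‖x‖ : ℂ) • u := by rw [hu, smul_smul, mul_inv_cancel₀ hn, one_smul]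
    have h2 := congrArg (starRingEnd ℂ) (h u hun)
    rw [inner_conj_symm, inner_conj_symm] at h2
    generalize (‖x‖ : ℂ) = r at hxu
    rw [hxu]
    simp [inner_smul_left, inner_smul_right, h2]
  exact ContinuousLinearMap.coe_injective this

theorem exists_orthonormal3 (hdim : 3 ≤ Module.rank ℂ H) : ∃ v : Fin 3 → H, Orthonormal ℂ v := by
  have h : ((3 : ℕ) : Cardinal) ≤ Module.rank ℂ H := by exact_mod_cast hdim
  obtain ⟨g, hg⟩ := Module.le_rank_iff_exists_linearMap.mp h
  have hli : LinearIndependent ℂ (fun i : Fin 3 => g (Pi.basisFun ℂ (Fin 3) i)) :=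
    (Pi.basisFun ℂ (Fin 3)).linearIndependent.map' g (LinearMap.ker_eq_bot.mpr hg)
  exact ⟨_, InnerProductSpace.gramSchmidtNormed_orthonormal hli⟩

/-- The symmetric operator `x ⊗ e + e ⊗ x`. -/
noncomputable def Sy (e x : H) : H →L[ℂ] H := rankOne ℂ x e + rankOne ℂ e x

theorem Sy_apply (e x z : H) : Sy e x z = (inner ℂ e z : ℂ) • x + (inner ℂ x z : ℂ) • e := rfl

theorem Sy_sa (e x : H) : IsSelfAdjoint (Sy e x) := by
  rw [IsSelfAdjoint, Sy, star_add, star_rankOne, star_rankOne, add_comm]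

theorem Sy_add (e x y : H) : Sy e (x + y) = Sy e x + Sy e y := by
  ext z
  simp only [Sy_apply, add_apply, inner_add_left, smul_add, add_smul]; abel

theorem Sy_smul (e x : H) (t : ℝ) : Sy e ((t : ℂ) • x) = (t : ℂ) • Sy e x := by
  ext z
  simp only [Sy_apply, smul_apply, inner_smul_left, smul_add, smul_smul, Complex.conj_ofReal]
  congr 2; ring

theorem Sy_sq {e x : H} (he : ‖e‖ = 1) (hx : inner ℂ e x = (0 : ℂ)) :
    Sy e x * Sy e x = ((‖x‖ ^ 2 : ℝ) : ℂ) • pr e + pr x := by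
  have hx' : inner ℂ x e = (0 : ℂ) := by rw [← inner_conj_symm, hx, map_zero]
  ext z
  simp only [mula, Sy_apply, add_apply, smul_apply, pr_apply, inner_add_right, inner_smul_right,
    hx, hx', inner_unit he, inner_self' x, mul_zero, mul_one, zero_add, add_zero, smul_smul]
  rw [add_comm, mul_comm]

theorem Sy_jordan {e x : H} (he : ‖e‖ = 1) (hx : inner ℂ e x = (0 : ℂ)) :
    pr e * Sy e x + Sy e x * pr e = Sy e x := by
  have hx' : inner ℂ x e = (0 : ℂ) := by rw [← inner_conj_symm, hx, map_zero]
  ext z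
  simp only [mula, Sy_apply, add_apply, pr_apply, inner_add_right, inner_smul_right,
    hx, hx', inner_unit he, mul_zero, mul_one, zero_add, add_zero, zero_smul, one_smul, smul_add]
  rw [add_comm]

theorem pr_decomp (e x : H) (c : ℂ) :
    pr (c • e + x) = ((‖c‖ ^ 2 : ℝ) : ℂ) • pr e + pr x + Sy e (starRingEnd ℂ c • x) := by
  have h : ((‖c‖ ^ 2 : ℝ) : ℂ) = starRingEnd ℂ c * c := by
    rw [← Complex.normSq_eq_conj_mul_self, Complex.normSq_eq_norm_sq]
  rw [h]
  ext z
  simp only [Sy_apply, add_apply, smul_apply, pr_apply, inner_add_left, inner_smul_left, smul_add,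
    add_smul, smul_smul, Complex.conj_conj]
  module

theorem pr_smul (c : ℂ) (x : H) : pr (c • x) = ((‖c‖ ^ 2 : ℝ) : ℂ) • pr x := by
  have h : ((‖c‖ ^ 2 : ℝ) : ℂ) = starRingEnd ℂ c * c := by
    rw [← Complex.normSq_eq_conj_mul_self, Complex.normSq_eq_norm_sq]
  rw [h]
  ext z
  simp only [smul_apply, pr_apply, inner_smul_left, smul_smul]
  congr 1; ring

theorem pr_eq_pr {a b : H} (h : pr a = pr b) : ∃ c : ℂ, a = c • b := by
  by_cases ha : a = 0
  · exact ⟨0, by simp [ha]⟩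
  have h1 := congrArg (fun T : H →L[ℂ] H => T a) h
  simp only [pr_apply] at h1
  have hne : (inner ℂ a a : ℂ) ≠ 0 := inner_self_ne_zero.mpr ha
  refine ⟨(inner ℂ a a : ℂ)⁻¹ * inner ℂ b a, ?_⟩
  rw [mul_smul, ← h1, smul_smul, inv_mul_cancel₀ hne, one_smul]

/-- Linear Jordan maps. -/
structure JL (φ : (H →L[ℂ] H) → (H →L[ℂ] H)) (e e' : H) : Prop extends JT φ where
  add : ∀ A B, IsSelfAdjoint A → IsSelfAdjoint B → φ (A + B) = φ A + φ B
  smul : ∀ (t : ℝ) A, IsSelfAdjoint A → φ ((t : ℂ) • A) = (t : ℂ) • φ A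
  he : ‖e‖ = 1
  he' : ‖e'‖ = 1
  pre : φ (pr e) = pr e'
  quade : ∀ A, IsSelfAdjoint A → inner ℂ e' (φ A e') = (inner ℂ e (A e) : ℂ)

theorem JT.toJL {φ : (H →L[ℂ] H) → (H →L[ℂ] H)} (hφ : JT φ)
    (v : Fin 3 → H) (hv : Orthonormal ℂ v) : ∃ e e' : H, JL φ e e' := by
  have hv1 : ∀ i, ‖v i‖ = 1 := hv.1
  obtain ⟨e', he', h⟩ := hφ.pr_map (hv1 0)
  refine ⟨v 0, e', { hφ with
    add := ?_, smul := ?_, he := hv1 0, he' := he', pre := h,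
    quade := fun A hA => hφ.quad v hv (hv1 0) he' h hA }⟩
  · intro A B hA hB
    apply ext_unit
    intro y hy
    obtain ⟨x, hx, hxy⟩ := hφ.pr_comap hy
    rw [add_apply, inner_add_right, hφ.quad v hv hx hy hxy hA, hφ.quad v hv hx hy hxy hB,
      hφ.quad v hv hx hy hxy (hA.add hB), add_apply, inner_add_right]
  · intro t A hA
    apply ext_unit
    intro y hy
    obtain ⟨x, hx, hxy⟩ := hφ.pr_comap hy
    rw [smul_apply, inner_smul_right, hφ.quad v hv hx hy hxy hA,
      hφ.quad v hv hx hy hxy (sa_smul t hA), smul_apply, inner_smul_right]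

namespace JL

variable {φ : (H →L[ℂ] H) → (H →L[ℂ] H)} {e e' : H}

theorem jordan (hφ : JL φ e e') {A B : H →L[ℂ] H} (hA : IsSelfAdjoint A) (hB : IsSelfAdjoint B) :
    φ (A * B + B * A) = φ A * φ B + φ B * φ A := by
  have hsq : ∀ A : H →L[ℂ] H, IsSelfAdjoint A → IsSelfAdjoint (A * A) := by
    intro A hA; rw [IsSelfAdjoint, star_mul, hA.star_eq]
  have hAB : IsSelfAdjoint (A * B + B * A) := by
    rw [IsSelfAdjoint, star_add, star_mul, star_mul, hA.star_eq, hB.star_eq, add_comm]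
  have h1 := hφ.toJT.sq (A + B) (hA.add hB)
  rw [show (A + B) * (A + B) = A * A + B * B + (A * B + B * A) by noncomm_ring,
    hφ.add _ _ ((hsq A hA).add (hsq B hB)) hAB, hφ.add _ _ (hsq A hA) (hsq B hB),
    hφ.toJT.sq A hA, hφ.toJT.sq B hB, hφ.add _ _ hA hB] at h1
  have h2 : (φ A + φ B) * (φ A + φ B) =
    φ A * φ A + φ B * φ B + (φ A * φ B + φ B * φ A) := by noncomm_ring
  rw [h2] at h1
  exact add_left_cancel h1

theorem Sy_map (hφ : JL φ e e') {x : H} (hx : inner ℂ e x = (0 : ℂ)) :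
    inner ℂ e' (φ (Sy e x) e') = (0 : ℂ) ∧ φ (Sy e x) = Sy e' (φ (Sy e x) e') ∧
    ‖φ (Sy e x) e'‖ = ‖x‖ ∧ φ (pr x) = pr (φ (Sy e x) e') := by
  have hx' : inner ℂ x e = (0 : ℂ) := by rw [← inner_conj_symm, hx, map_zero]
  set y := φ (Sy e x) e' with hy
  have hs := hφ.sa _ (Sy_sa e x)
  have h1 : inner ℂ e' y = (0 : ℂ) := by
    rw [hy, hφ.quade _ (Sy_sa e x), Sy_apply, inner_add_right, inner_smul_right, inner_smul_right,
      hx, hx']; simp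
  have h2 : φ (Sy e x) = Sy e' y := by
    have h := hφ.jordan (pr_sa e) (Sy_sa e x)
    rw [Sy_jordan hφ.he hx, hφ.pre] at h
    rw [h]
    ext z
    simp only [add_apply, mula, pr_apply, Sy_apply, map_smul]
    rw [← ContinuousLinearMap.adjoint_inner_left, ← star_eq_adjoint, hs.star_eq, ← hy, add_comm]
  have h3 := hφ.toJT.sq _ (Sy_sa e x)
  rw [Sy_sq hφ.he hx, h2, Sy_sq hφ.he' h1, hφ.add _ _ (sa_smul _ (pr_sa e)) (pr_sa x),
    hφ.smul _ _ (pr_sa e), hφ.pre] at h3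
  have h4 := congrArg (fun T : H →L[ℂ] H => (inner ℂ e' (T e') : ℂ)) h3
  simp only [add_apply, inner_add_right, hφ.quade _ (pr_sa x)] at h4
  have h1' : inner ℂ y e' = (0 : ℂ) := by rw [← inner_conj_symm, h1, map_zero]
  simp only [smul_apply, pr_apply, inner_smul_right, hx, hx', h1, h1', inner_unit hφ.he', mul_one,
    mul_zero, add_zero, zero_mul] at h4
  have h5 : ‖x‖ ^ 2 = ‖y‖ ^ 2 := by exact_mod_cast h4
  have h6 : ‖y‖ = ‖x‖ := by
    rw [sq_eq_sq₀ (norm_nonneg _) (norm_nonneg _)] at h5; exact h5.symm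
  refine ⟨h1, h2, h6, ?_⟩
  rw [h5] at h3
  exact add_left_cancel h3

end JL

/-- projection to the orthocomplement of `e` -/
noncomputable def Qp (e x : H) : H := x - (inner ℂ e x : ℂ) • e

theorem Qp_orth {e : H} (he : ‖e‖ = 1) (x : H) : inner ℂ e (Qp e x) = (0 : ℂ) := by
  rw [Qp, inner_sub_right, inner_smul_right, inner_unit he]; ring

theorem Qp_add (e x y : H) : Qp e (x + y) = Qp e x + Qp e y := by
  rw [Qp, Qp, Qp, inner_add_right, add_smul]; abel

theorem Qp_smul (e x : H) (c : ℂ) : Qp e (c • x) = c • Qp e x := by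
  rw [Qp, Qp, inner_smul_right, smul_sub, smul_smul]

theorem Qp_decomp (e x : H) : x = (inner ℂ e x : ℂ) • e + Qp e x := by
  rw [Qp]; abel

/-- real linear part -/
noncomputable def Tm (φ : (H →L[ℂ] H) → (H →L[ℂ] H)) (e e' x : H) : H := φ (Sy e (Qp e x)) e'

namespace JL

variable {φ : (H →L[ℂ] H) → (H →L[ℂ] H)} {e e' : H}

theorem T_add (hφ : JL φ e e') (x y : H) : Tm φ e e' (x + y) = Tm φ e e' x + Tm φ e e' y := by
  rw [Tm, Qp_add, Sy_add, hφ.add _ _ (Sy_sa _ _) (Sy_sa _ _)]; rfl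

theorem T_real (hφ : JL φ e e') (t : ℝ) (x : H) : Tm φ e e' ((t : ℂ) • x) = (t : ℂ) • Tm φ e e' x := by
  rw [Tm, Qp_smul, Sy_smul, hφ.smul _ _ (Sy_sa _ _)]; rfl

theorem T_norm (hφ : JL φ e e') (x : H) : ‖Tm φ e e' x‖ = ‖Qp e x‖ := (hφ.Sy_map (Qp_orth hφ.he x)).2.2.1

theorem T_pr (hφ : JL φ e e') (x : H) : φ (pr (Qp e x)) = pr (Tm φ e e' x) := (hφ.Sy_map (Qp_orth hφ.he x)).2.2.2

theorem T_Sy (hφ : JL φ e e') (x : H) : φ (Sy e (Qp e x)) = Sy e' (Tm φ e e' x) :=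
  (hφ.Sy_map (Qp_orth hφ.he x)).2.1

theorem T_I (hφ : JL φ e e') (x : H) : Tm φ e e' (Complex.I • x) = Complex.I • Tm φ e e' x ∨
    Tm φ e e' (Complex.I • x) = (-Complex.I) • Tm φ e e' x := by
  have h1 : pr (Tm φ e e' (Complex.I • x)) = pr (Tm φ e e' x) := by
    rw [← hφ.T_pr, ← hφ.T_pr, Qp_smul, pr_smul]; simp
  obtain ⟨c, hc⟩ := pr_eq_pr h1
  by_cases h0 : Tm φ e e' x = 0
  · left; rw [hc, h0]; simp
  have hn : ‖Tm φ e e' x‖ ≠ 0 := by simpa using h0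
  have n1 : ‖c‖ = 1 := by
    have h := hφ.T_norm (Complex.I • x)
    rw [hc, Qp_smul, norm_smul, norm_smul, ← hφ.T_norm x] at h
    simpa [hn] using h
  have n2 : ‖1 + c‖ = ‖1 + Complex.I‖ := by
    have h := hφ.T_norm (x + Complex.I • x)
    rw [hφ.T_add, hc, Qp_add, Qp_smul] at h
    have e1 : Tm φ e e' x + c • Tm φ e e' x = (1 + c) • Tm φ e e' x := by
      rw [add_smul, one_smul]
    have e2 : Qp e x + Complex.I • Qp e x = (1 + Complex.I) • Qp e x := by
      rw [add_smul, one_smul]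
    rw [e1, e2, norm_smul, norm_smul, ← hφ.T_norm x] at h
    exact mul_right_cancel₀ hn h
  have m1 : Complex.normSq c = 1 := by rw [Complex.normSq_eq_norm_sq, n1]; norm_num
  have m2 : Complex.normSq (1 + c) = Complex.normSq (1 + Complex.I) := by
    rw [Complex.normSq_eq_norm_sq, Complex.normSq_eq_norm_sq, n2]
  simp only [Complex.normSq_apply, Complex.add_re, Complex.add_im, Complex.one_re, Complex.one_im,
    Complex.I_re, Complex.I_im] at m1 m2
  have hre : c.re = 0 := by nlinarith
  rw [hre] at m1
  have him : (c.im - 1) * (c.im + 1) = 0 := by linear_combination m1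
  rcases mul_eq_zero.mp him with h | h
  · left; rw [hc]; congr 1; apply Complex.ext <;> simp [hre]; linarith
  · right; rw [hc]; congr 1; apply Complex.ext <;> simp [hre]; linarith

theorem T_type (hφ : JL φ e e') : (∀ x, Tm φ e e' (Complex.I • x) = Complex.I • Tm φ e e' x) ∨
    (∀ x, Tm φ e e' (Complex.I • x) = (-Complex.I) • Tm φ e e' x) := by
  by_contra! hcon
  obtain ⟨⟨x, hx⟩, ⟨y, hy⟩⟩ := hcon
  have hx' := (hφ.T_I x).resolve_left hx
  have hy' := (hφ.T_I y).resolve_right hy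
  have h := hφ.T_I (x + y)
  rw [smul_add, hφ.T_add, hφ.T_add, hx', hy', smul_add, smul_add] at h
  rcases h with h | h
  · exact hx (by rw [hx']; exact add_right_cancel h)
  · exact hy (by rw [hy']; exact add_left_cancel h)

theorem T_smul (hφ : JL φ e e') {J : ℂ} (hJ : ∀ x, Tm φ e e' (Complex.I • x) = J • Tm φ e e' x)
    (c : ℂ) (x : H) : Tm φ e e' (c • x) = ((c.re : ℂ) + c.im * J) • Tm φ e e' x := by
  conv_lhs => rw [← Complex.re_add_im c, add_smul, mul_smul]
  rw [hφ.T_add, hφ.T_real, hφ.T_real, hJ, add_smul, mul_smul]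

end JL

/-- the inducing operator -/
noncomputable def Um (φ : (H →L[ℂ] H) → (H →L[ℂ] H)) (σ : ℂ →+* ℂ) (e e' x : H) : H :=
  σ (inner ℂ e x) • e' + Tm φ e e' x

namespace JL

variable {φ : (H →L[ℂ] H) → (H →L[ℂ] H)} {e e' : H}

theorem U_add (hφ : JL φ e e') (σ : ℂ →+* ℂ) (x y : H) :
    Um φ σ e e' (x + y) = Um φ σ e e' x + Um φ σ e e' y := by
  rw [Um, Um, Um, hφ.T_add, inner_add_right, map_add, add_smul]; abel

theorem U_smul (hφ : JL φ e e') (σ : ℂ →+* ℂ) (hT : ∀ (c : ℂ) x, Tm φ e e' (c • x) = σ c • Tm φ e e' x)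
    (c : ℂ) (x : H) :
    Um φ σ e e' (c • x) = σ c • Um φ σ e e' x := by
  rw [Um, Um, hT, inner_smul_right, map_mul, smul_add, smul_smul]

theorem U_pr (hφ : JL φ e e') (σ : ℂ →+* ℂ) (hT : ∀ (c : ℂ) x, Tm φ e e' (c • x) = σ c • Tm φ e e' x)
    (hn : ∀ c, ‖σ c‖ = ‖c‖) (hs : ∀ c, starRingEnd ℂ (σ c) = σ (starRingEnd ℂ c)) (x : H) :
    φ (pr x) = pr (Um φ σ e e' x) := by
  have h : pr x = pr ((inner ℂ e x : ℂ) • e + Qp e x) := by rw [← Qp_decomp]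
  rw [h, pr_decomp, Um, pr_decomp, ← Qp_smul,
    hφ.add _ _ ((sa_smul _ (pr_sa _)).add (pr_sa _)) (Sy_sa _ _),
    hφ.add _ _ (sa_smul _ (pr_sa _)) (pr_sa _), hφ.smul _ _ (pr_sa _), hφ.pre, hφ.T_pr, hφ.T_Sy,
    hT, hn, hs]

theorem U_norm (hφ : JL φ e e') {U : H → H} (hU : ∀ x, φ (pr x) = pr (U x)) (x : H) : ‖U x‖ = ‖x‖ := by
  have hprsq : ∀ y : H, pr y * pr y = ((‖y‖ ^ 2 : ℝ) : ℂ) • pr y := by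
    intro y
    ext z
    simp only [mula, smul_apply, pr_apply, map_smul, inner_self', smul_smul, mul_comm,
      inner_smul_right]
  have h := hφ.toJT.sq _ (pr_sa x)
  rw [hprsq, hφ.smul _ _ (pr_sa x), hU, hprsq] at h
  by_cases h0 : U x = 0
  · have := hU x
    have hz : φ (pr x) = 0 := by rw [this, h0]; ext z; simp [pr_apply]
    rw [hφ.toJT.eq_zero_iff (pr_sa x)] at hz
    have : x = 0 := by
      by_contra hx
      exact pr_ne_zero hx hz
    rw [h0, this]
  · have := smul_left_injective ℂ (pr_ne_zero h0) h
    have h5 : ‖x‖ ^ 2 = ‖U x‖ ^ 2 := by exact_mod_cast this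
    rw [sq_eq_sq₀ (norm_nonneg _) (norm_nonneg _)] at h5; exact h5.symm

theorem U_quad (hφ : JL φ e e') {U : H → H} (hU : ∀ x, φ (pr x) = pr (U x)) (x : H)
    {A : H →L[ℂ] H} (hA : IsSelfAdjoint A) :
    inner ℂ (U x) (φ A (U x)) = (inner ℂ x (A x) : ℂ) := by
  have h := hφ.triple _ _ (pr_sa x) hA
  rw [pr_mul_mul, ← inner_sa_real hA, hφ.smul _ _ (pr_sa x), hU, pr_mul_mul, inner_sa_real hA] at h
  by_cases h0 : U x = 0
  · have h1 := hφ.U_norm hU x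
    rw [h0, norm_zero] at h1
    have : x = 0 := norm_eq_zero.mp h1.symm
    rw [h0, this]; simp
  · exact (smul_left_injective ℂ (pr_ne_zero h0) h).symm

theorem U_surj (hφ : JL φ e e') {U : H → H} (hU : ∀ x, φ (pr x) = pr (U x)) (σ : ℂ →+* ℂ)
    (hσ : ∀ c, σ (σ c) = c) (hsm : ∀ (c : ℂ) x, U (c • x) = σ c • U x) :
    Function.Surjective U := by
  intro y
  by_cases hy : y = 0
  · refine ⟨0, ?_⟩
    have := hφ.U_norm hU 0
    rw [norm_zero, norm_eq_zero] at this
    rw [this, hy]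
  have hn : (‖y‖ : ℂ) ≠ 0 := by simpa using hy
  set u : H := ((‖y‖ : ℂ)⁻¹) • y with hu
  have hun : ‖u‖ = 1 := by
    rw [hu, norm_smul]; simp [hy]
  have hxu : y = (‖y‖ : ℂ) • u := by rw [hu, smul_smul, mul_inv_cancel₀ hn, one_smul]
  obtain ⟨x, hx, hxy⟩ := hφ.toJT.pr_comap hun
  rw [hU] at hxy
  obtain ⟨c, hc⟩ := pr_eq_pr hxy.symm
  refine ⟨σ ((‖y‖ : ℂ) * c) • x, ?_⟩
  rw [hsm, hσ, mul_smul, ← hc, ← hxu]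

end JL

theorem main_normalised {φ : (H →L[ℂ] H) → (H →L[ℂ] H)} (hφ : JT φ)
    (v : Fin 3 → H) (hv : Orthonormal ℂ v) :
    (∃ U : H →L[ℂ] H, U ∈ unitary (H →L[ℂ] H) ∧
      (∀ A : H →L[ℂ] H, IsSelfAdjoint A → φ A = U * A * star U)) ∨
    (∃ V : H ≃ₛₗᵢ[starRingEnd ℂ] H,
      (∀ A : H →L[ℂ] H, IsSelfAdjoint A → ∀ x : H, φ A x = V (A (V.symm x)))) := by
  obtain ⟨e, e', hL⟩ := hφ.toJL v hv
  rcases hL.T_type with hT | hT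
  · left
    have hT' := hL.T_smul hT
    have hTσ : ∀ (c : ℂ) x, Tm φ e e' (c • x) = RingHom.id ℂ c • Tm φ e e' x := by
      intro c x; rw [hT', Complex.re_add_im]; rfl
    have hadd := hL.U_add (RingHom.id ℂ)
    have hsm := hL.U_smul _ hTσ
    have hpr := hL.U_pr _ hTσ (fun _ => rfl) (fun _ => rfl)
    have hnorm := hL.U_norm hpr
    have hsurj := hL.U_surj hpr (RingHom.id ℂ) (fun _ => rfl) hsm
    let f : H →ₗᵢ[ℂ] H :=
      { toFun := Um φ (RingHom.id ℂ) e e', map_add' := hadd, map_smul' := hsm, norm_map' := hnorm }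
    let V : H ≃ₗᵢ[ℂ] H := LinearIsometryEquiv.ofSurjective f hsurj
    have hV : ∀ x, V x = Um φ (RingHom.id ℂ) e e' x := fun x => rfl
    let W := Unitary.linearIsometryEquiv.symm V
    have hW : ∀ x, (W : H →L[ℂ] H) x = V x := fun x => rfl
    refine ⟨W, W.2, ?_⟩
    intro A hA
    have hWW : star (W : H →L[ℂ] H) * W = 1 := Unitary.coe_star_mul_self W
    apply ext_unit
    intro y _
    obtain ⟨x, rfl⟩ := V.surjective y
    have h1 : star (W : H →L[ℂ] H) (V x) = x := by
      rw [← hW, ← mula, hWW]; rfl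
    rw [mula, mula, h1, hV x, hL.U_quad hpr x hA, ← hV x, hW, LinearIsometryEquiv.inner_map_map]
  · right
    have hT' := hL.T_smul hT
    have hTσ : ∀ (c : ℂ) x, Tm φ e e' (c • x) = starRingEnd ℂ c • Tm φ e e' x := by
      intro c x; rw [hT']; congr 1; apply Complex.ext <;> simp
    have hadd := hL.U_add (starRingEnd ℂ)
    have hsm := hL.U_smul _ hTσ
    have hpr := hL.U_pr _ hTσ (fun _ => by simp) (fun _ => rfl)
    have hnorm := hL.U_norm hpr
    have hsurj := hL.U_surj hpr (starRingEnd ℂ) (fun _ => by simp) hsm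
    let f : H →ₛₗᵢ[starRingEnd ℂ] H :=
      { toFun := Um φ (starRingEnd ℂ) e e', map_add' := hadd, map_smul' := hsm, norm_map' := hnorm }
    let V : H ≃ₛₗᵢ[starRingEnd ℂ] H := LinearIsometryEquiv.ofSurjective f hsurj
    have hV : ∀ x, V x = Um φ (starRingEnd ℂ) e e' x := fun x => rfl
    refine ⟨V, ?_⟩
    intro A hA
    let B : H →ₗ[ℂ] H :=
      { toFun := fun x => V (A (V.symm x))
        map_add' := by intro x y; simp
        map_smul' := by intro c x; simp [map_smulₛₗ] }
    have hB : ∀ x, B (V x) = V (A x) := by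
      intro x; change V (A (V.symm (V x))) = _; rw [V.symm_apply_apply]
    have hinner : ∀ x y, (inner ℂ (V x) (V y) : ℂ) = inner ℂ y x := by
      intro x y
      have hI : ∀ z, V (Complex.I • z) = -(Complex.I • V z) := by intro z; simp [map_smulₛₗ]
      rw [inner_eq_sum_norm_sq_div_four, inner_eq_sum_norm_sq_div_four (𝕜 := ℂ) y x]
      simp only [RCLike.I_to_complex]
      have a1 : ‖V x + V y‖ = ‖y + x‖ := by rw [← map_add, V.norm_map, add_comm]
      have a2 : ‖V x - V y‖ = ‖y - x‖ := by rw [← map_sub, V.norm_map, norm_sub_rev]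
      have a3 : ‖V x - Complex.I • V y‖ = ‖y - Complex.I • x‖ := by
        rw [show V x - Complex.I • V y = V (x + Complex.I • y) by rw [map_add, hI]; abel,
          V.norm_map, show x + Complex.I • y = Complex.I • (y - Complex.I • x) by
            rw [smul_sub, smul_smul, Complex.I_mul_I]; simp [add_comm], norm_smul]; simp
      have a4 : ‖V x + Complex.I • V y‖ = ‖y + Complex.I • x‖ := by
        rw [show V x + Complex.I • V y = V (x - Complex.I • y) by rw [map_sub, hI]; abel,
          V.norm_map, show x - Complex.I • y = (-Complex.I) • (y + Complex.I • x) by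
            rw [smul_add, smul_smul, neg_mul, Complex.I_mul_I]; simp [sub_eq_add_neg, add_comm],
          norm_smul]; simp
      rw [a1, a2, a3, a4]
    have : ((φ A : H →L[ℂ] H) : H →ₗ[ℂ] H) = B := by
      rw [← ext_inner_map]
      intro y
      obtain ⟨x, rfl⟩ := V.surjective y
      rw [hB, hinner, hV x, ContinuousLinearMap.coe_coe, ← inner_conj_symm, hL.U_quad hpr x hA,
        ← inner_sa_real hA, Complex.conj_ofReal]
    intro x
    exact congrArg (fun T : H →ₗ[ℂ] H => T x) this

end JTM

/-- If `dim H ≥ 3`, every bijection of the set of bounded self-adjoint operators on `H` that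
is multiplicative with respect to the Jordan triple product `(A, B) ↦ ABA` is of the form
`A ↦ U A U*` or `A ↦ -U A U*` for a unitary or antiunitary operator `U`. -/
theorem jordan_triple_bijection_of_selfAdjoint
    {H : Type*} [NormedAddCommGroup H] [InnerProductSpace ℂ H] [CompleteSpace H]
    (hdim : 3 ≤ Module.rank ℂ H)
    (φ : (H →L[ℂ] H) → (H →L[ℂ] H))
    (hbij : Set.BijOn φ {A : H →L[ℂ] H | IsSelfAdjoint A} {A : H →L[ℂ] H | IsSelfAdjoint A})
    (htriple : ∀ A : H →L[ℂ] H, IsSelfAdjoint A → ∀ B : H →L[ℂ] H, IsSelfAdjoint B →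
      φ (A * B * A) = φ A * φ B * φ A) :
    (∃ U : H →L[ℂ] H, U ∈ unitary (H →L[ℂ] H) ∧
      ((∀ A : H →L[ℂ] H, IsSelfAdjoint A → φ A = U * A * star U) ∨
       (∀ A : H →L[ℂ] H, IsSelfAdjoint A → φ A = -(U * A * star U)))) ∨
    (∃ V : H ≃ₛₗᵢ[starRingEnd ℂ] H,
      ((∀ A : H →L[ℂ] H, IsSelfAdjoint A → ∀ x : H, φ A x = V (A (V.symm x))) ∨
       (∀ A : H →L[ℂ] H, IsSelfAdjoint A → ∀ x : H, φ A x = -V (A (V.symm x))))) := by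
  open JTM in
  obtain ⟨v, hv⟩ := exists_orthonormal3 hdim
  have hnt : Nontrivial H := ⟨v 0, 0, ne_zero_of_unit (hv.1 0)⟩
  have hsurj : ∀ B : H →L[ℂ] H, IsSelfAdjoint B → ∃ A : H →L[ℂ] H, IsSelfAdjoint A ∧ φ A = B :=
    fun B hB => hbij.surjOn hB
  have hJsa : IsSelfAdjoint (φ 1) := hbij.mapsTo (sa_one (H := H))
  have hJ : ∀ X : H →L[ℂ] H, IsSelfAdjoint X → φ 1 * X * φ 1 = X := by
    intro X hX
    obtain ⟨A, hA, rfl⟩ := hsurj X hX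
    rw [← htriple 1 sa_one A hA, one_mul, mul_one]
  have hJ2 : φ 1 * φ 1 = 1 := by
    have := hJ 1 sa_one
    rwa [mul_one] at this
  obtain ⟨c, hc⟩ := scalar_of_commute (φ 1) (by
    intro x _
    have h := hJ (pr x) (pr_sa x)
    calc φ 1 * pr x = φ 1 * pr x * (φ 1 * φ 1) := by rw [hJ2, mul_one]
      _ = (φ 1 * pr x * φ 1) * φ 1 := by rw [← mul_assoc]
      _ = pr x * φ 1 := by rw [h])
  have hcc : (c - 1) * (c + 1) = 0 := by
    rw [hc, smul_mul_smul_comm, mul_one] at hJ2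
    have h : (c * c) • (1 : H →L[ℂ] H) = (1 : ℂ) • 1 := by rw [hJ2, one_smul]
    have := smul_left_injective ℂ (one_ne_zero (α := H →L[ℂ] H)) h
    linear_combination this
  rcases mul_eq_zero.mp hcc with h | h
  · have hφ : JT φ :=
      { sa := fun A hA => hbij.mapsTo hA
        inj := fun A B hA hB h => hbij.injOn hA hB h
        surj := hsurj
        triple := fun A B hA hB => htriple A hA B hB
        one := by rw [hc, sub_eq_zero.mp h, one_smul] }
    rcases main_normalised hφ v hv with ⟨U, hU, h⟩ | ⟨V, h⟩
    · exact Or.inl ⟨U, hU, Or.inl h⟩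
    · exact Or.inr ⟨V, Or.inl h⟩
  · have hφ : JT (fun A => -φ A) :=
      { sa := fun A hA => IsSelfAdjoint.neg (hbij.mapsTo hA)
        inj := fun A B hA hB h => hbij.injOn hA hB (neg_injective h)
        surj := fun B hB => by
          obtain ⟨A, hA, h⟩ := hsurj (-B) hB.neg
          exact ⟨A, hA, by rw [h, neg_neg]⟩
        triple := fun A B hA hB => by
          simp only [htriple A hA B hB]; noncomm_ring
        one := by rw [hc, eq_neg_of_add_eq_zero_left h, neg_smul, one_smul, neg_neg] }
    rcases main_normalised hφ v hv with ⟨U, hU, h⟩ | ⟨V, h⟩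
    · exact Or.inl ⟨U, hU, Or.inr fun A hA => by rw [← h A hA, neg_neg]⟩
    · exact Or.inr ⟨V, Or.inr fun A hA x => by rw [← h A hA x]; simp⟩
end

section
/- Let H be a complex Hilbert space with dim H ≥ 3, [0,I] the set of effects on H, and φ : [0,I] → [0,I] a bijective map satisfying φ(ABA) = φ(A)φ(B)φ(A) for all A, B ∈ [0,I]. Then φ(λP) = λφ(P) for every λ ∈ [0,1] and every rank-one projection P on H. -/
set_option linter.unusedSimpArgs false

open InnerProductSpace in
theorem aux_exists_decomp {H : Type*} [NormedAddCommGroup H] [InnerProductSpace ℂ H]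
    [CompleteSpace H] (hdim : 3 ≤ Module.rank ℂ H) (Q : H →L[ℂ] H) (hQ : IsSelfAdjoint Q)
    (hQQ : Q * Q = Q) (hr : Module.finrank ℂ (LinearMap.range (Q : H →ₗ[ℂ] H)) = 1)
    (t : ℝ) (h0 : 0 ≤ t) (h1 : t ≤ 1) :
    ∃ P₁ P₂ : H →L[ℂ] H, IsSelfAdjoint P₁ ∧ IsSelfAdjoint P₂ ∧ P₁ * P₁ = P₁ ∧ P₂ * P₂ = P₂ ∧
      P₁ * P₂ = 0 ∧ (P₁ + P₂) * Q = Q ∧ Q * P₁ * Q = (t : ℂ) • Q ∧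
      Q * P₂ * Q = ((1 - t : ℝ) : ℂ) • Q := by
  -- unit vector
  obtain ⟨⟨x0, hx0⟩, hx0ne, hspan⟩ := finrank_eq_one_iff'.mp hr
  have hfix : ∀ z, Q (Q z) = Q z := fun z => by
    have := congrArg (fun A : H →L[ℂ] H => A z) hQQ
    simpa using this
  have hx0ne' : x0 ≠ 0 := fun h => hx0ne (by simpa using h)
  have hn : ‖x0‖ ≠ 0 := norm_ne_zero_iff.mpr hx0ne'
  obtain ⟨x, hxn, hQx, hQz⟩ : ∃ x : H, ‖x‖ = 1 ∧ Q x = x ∧ ∀ z, ∃ c : ℂ, Q z = c • x := by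
    refine ⟨((‖x0‖⁻¹ : ℝ) : ℂ) • x0, ?_, ?_, ?_⟩
    · rw [norm_smul]; simp [hn]
    · obtain ⟨w, hw⟩ := hx0
      have : Q x0 = x0 := by
        have hw' : Q w = x0 := hw
        rw [← hw', hfix]
      rw [map_smul, this]
    · intro z
      obtain ⟨c, hc⟩ := hspan ⟨Q z, ⟨z, rfl⟩⟩
      have hc' : c • x0 = Q z := congrArg Subtype.val hc
      refine ⟨c * (‖x0‖ : ℂ), ?_⟩
      rw [← hc', smul_smul, mul_assoc]
      have : (‖x0‖ : ℂ) * ((‖x0‖⁻¹ : ℝ) : ℂ) = 1 := by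
        rw [← Complex.ofReal_mul, mul_inv_cancel₀ hn, Complex.ofReal_one]
      rw [this, mul_one]
  have hxx : inner ℂ x x = 1 := by
    rw [inner_self_eq_norm_sq_to_K, hxn]; simp
  have hQf : ∀ z, Q z = inner ℂ x z • x := by
    intro z
    obtain ⟨c, hc⟩ := hQz z
    have h2 : inner ℂ x (Q z) = inner ℂ (Q x) z := by
      have := ContinuousLinearMap.adjoint_inner_right Q x z
      rwa [hQ.adjoint_eq] at this
    rw [hQx, hc, inner_smul_right, hxx, mul_one] at h2
    rw [hc, h2]
  obtain ⟨y, hyn, hxy⟩ : ∃ y : H, ‖y‖ = 1 ∧ inner ℂ x y = 0 := by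
    have hne : (Submodule.span ℂ {x})ᗮ ≠ ⊥ := by
      intro h
      rw [Submodule.orthogonal_eq_bot_iff] at h
      have h3 : Module.rank ℂ (Submodule.span ℂ {x}) ≤ 1 := by
        refine (rank_span_le _).trans ?_
        simp
      rw [h, rank_top] at h3
      have := hdim.trans h3
      norm_num at this
    obtain ⟨y, hy, hy0⟩ := Submodule.exists_mem_ne_zero_of_ne_bot hne
    have hy' : inner ℂ x y = 0 := (Submodule.mem_orthogonal_singleton_iff_inner_right).mp hy
    refine ⟨((‖y‖⁻¹ : ℝ) : ℂ) • y, ?_, ?_⟩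
    · rw [norm_smul]; simp [hy0]
    · rw [inner_smul_right, hy', mul_zero]
  have hyy : inner ℂ y y = 1 := by
    rw [inner_self_eq_norm_sq_to_K, hyn]; simp
  have hyx : inner ℂ y x = 0 := by rw [← inner_conj_symm, hxy]; simp
  obtain ⟨a, b, ha, hb, hab⟩ : ∃ a b : ℝ, a * a = t ∧ b * b = 1 - t ∧ a * a + b * b = 1 :=
    ⟨√t, √(1 - t), Real.mul_self_sqrt h0, Real.mul_self_sqrt (by linarith), by
      rw [Real.mul_self_sqrt h0, Real.mul_self_sqrt (by linarith)]; ring⟩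
  have haC : (a : ℂ) * a = t := by exact_mod_cast ha
  have hbC : (b : ℂ) * b = ((1 - t : ℝ) : ℂ) := by exact_mod_cast hb
  have habC : (a : ℂ) * a + b * b = 1 := by exact_mod_cast hab
  set u : H := (a : ℂ) • x + (b : ℂ) • y with hu
  set v : H := (b : ℂ) • x - (a : ℂ) • y with hv
  have huu : inner ℂ u u = 1 := by
    simp only [hu, hv, inner_add_left, inner_add_right, inner_sub_left, inner_sub_right,
      inner_smul_left, inner_smul_right, hxx, hyy, hxy, hyx, Complex.conj_ofReal]
    linear_combination habC
  have hvv : inner ℂ v v = 1 := by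
    simp only [hu, hv, inner_add_left, inner_add_right, inner_sub_left, inner_sub_right,
      inner_smul_left, inner_smul_right, hxx, hyy, hxy, hyx, Complex.conj_ofReal]
    linear_combination habC
  have huv : inner ℂ u v = 0 := by
    simp only [hu, hv, inner_add_left, inner_add_right, inner_sub_left, inner_sub_right,
      inner_smul_left, inner_smul_right, hxx, hyy, hxy, hyx, Complex.conj_ofReal]
    ring
  have hux : inner ℂ u x = a := by
    simp only [hu, hv, inner_add_left, inner_add_right, inner_sub_left, inner_sub_right,
      inner_smul_left, inner_smul_right, hxx, hyy, hxy, hyx, Complex.conj_ofReal]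
    ring
  have hvx : inner ℂ v x = b := by
    simp only [hu, hv, inner_add_left, inner_add_right, inner_sub_left, inner_sub_right,
      inner_smul_left, inner_smul_right, hxx, hyy, hxy, hyx, Complex.conj_ofReal]
    ring
  have hxu : inner ℂ x u = a := by
    simp only [hu, hv, inner_add_left, inner_add_right, inner_sub_left, inner_sub_right,
      inner_smul_left, inner_smul_right, hxx, hyy, hxy, hyx, Complex.conj_ofReal]
    ring
  have hxv : inner ℂ x v = b := by
    simp only [hu, hv, inner_add_left, inner_add_right, inner_sub_left, inner_sub_right,
      inner_smul_left, inner_smul_right, hxx, hyy, hxy, hyx, Complex.conj_ofReal]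
    ring
  have hsa : ∀ w : H, IsSelfAdjoint (rankOne ℂ w w) := fun w => by
    rw [ContinuousLinearMap.isSelfAdjoint_iff', adjoint_rankOne]
  refine ⟨rankOne ℂ u u, rankOne ℂ v v, hsa u, hsa v, ?_, ?_, ?_, ?_, ?_, ?_⟩
  · ext z; simp only [mul_apply_eq_comp, rankOne_apply, inner_smul_right, huu, mul_one]
  · ext z; simp only [mul_apply_eq_comp, rankOne_apply, inner_smul_right, hvv, mul_one]
  · ext z; simp [huv, inner_smul_right]
  · ext z
    simp only [mul_apply_eq_comp, add_apply, rankOne_apply, hQf,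
      inner_smul_right, hux, hvx, mul_smul, ← smul_add]
    congr 1
    rw [hu, hv, smul_add, smul_sub, smul_smul, smul_smul, smul_smul, smul_smul]
    have : x = ((a : ℂ) * a + b * b) • x := by rw [habC, one_smul]
    conv_rhs => rw [this]
    rw [add_smul, mul_comm (b : ℂ) a]
    abel
  · ext z
    simp only [mul_apply_eq_comp, smul_apply, rankOne_apply, hQf,
      inner_smul_right, hux, hxu, smul_smul]
    congr 1
    linear_combination (inner ℂ x z) * haC
  · ext z
    simp only [mul_apply_eq_comp, smul_apply, rankOne_apply, hQf,
      inner_smul_right, hvx, hxv, smul_smul]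
    congr 1
    linear_combination (inner ℂ x z) * hbC

theorem aux_additive (g : ℝ → ℝ) (hg : ∀ a, 0 ≤ a → a ≤ 1 → 0 ≤ g a)
    (hadd : ∀ a b, 0 ≤ a → 0 ≤ b → a + b ≤ 1 → g (a + b) = g a + g b) :
    ∀ t, 0 ≤ t → t ≤ 1 → g t = t * g 1 := by
  have hz : g 0 = 0 := by
    have := hadd 0 0 le_rfl le_rfl (by norm_num)
    simp at this; exact this
  have hmono : ∀ a b, 0 ≤ a → a ≤ b → b ≤ 1 → g a ≤ g b := by
    intro a b ha hab hb
    have h := hadd a (b - a) ha (by linarith) (by linarith)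
    have h' := hg (b - a) (by linarith) (by linarith)
    rw [add_sub_cancel] at h
    linarith
  have hmul : ∀ (s : ℝ), 0 ≤ s → ∀ k : ℕ, k * s ≤ 1 → g (k * s) = k * g s := by
    intro s hs k
    induction k with
    | zero => intro _; simp [hz]
    | succ k ih =>
      intro h
      push_cast at h ⊢
      have hk : (k : ℝ) * s ≤ 1 := by nlinarith
      rw [add_mul, one_mul, hadd _ _ (by positivity) hs (by linarith), ih hk]
      ring
  have hrat : ∀ (n k : ℕ), 0 < n → k ≤ n → g (k / n) = k / n * g 1 := by
    intro n k hn hk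
    have hn' : (0 : ℝ) < n := by exact_mod_cast hn
    have hk' : (k : ℝ) ≤ n := by exact_mod_cast hk
    have e1 := hmul (1 / n) (by positivity) n (by rw [mul_one_div_cancel hn'.ne'])
    have e2 := hmul (1 / n) (by positivity) k (by rw [mul_one_div, div_le_one hn']; exact hk')
    rw [mul_one_div_cancel hn'.ne'] at e1
    rw [mul_one_div] at e2
    rw [e2, e1]; field_simp
  intro t h0 h1
  have hg1 := hg 1 zero_le_one le_rfl
  have hbound : ∀ n : ℕ, 0 < n → |g t - t * g 1| ≤ g 1 / n := by
    intro n hn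
    have hn' : (0 : ℝ) < n := by exact_mod_cast hn
    rcases eq_or_lt_of_le h1 with rfl | hlt
    · simp; positivity
    have hk1 := Nat.floor_le (show 0 ≤ t * n by positivity)
    have hk2 := Nat.lt_floor_add_one (t * n)
    set k := ⌊t * n⌋₊
    have hkn : k + 1 ≤ n := by
      have : (k : ℝ) < n := by nlinarith
      exact_mod_cast this
    have hkn' : ((k + 1 : ℕ) : ℝ) ≤ n := by exact_mod_cast hkn
    have A := hmono (k / n) t (by positivity) (by rw [div_le_iff₀ hn']; exact hk1) h1
    have B := hmono t ((k + 1 : ℕ) / n) h0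
      (by rw [le_div_iff₀ hn']; push_cast; exact hk2.le) (by rw [div_le_one hn']; exact hkn')
    rw [hrat n k hn (by omega)] at A
    rw [hrat n (k + 1) hn hkn] at B
    have C : (k : ℝ) / n * g 1 ≤ t * g 1 :=
      mul_le_mul_of_nonneg_right (by rw [div_le_iff₀ hn']; exact hk1) hg1
    have D : t * g 1 ≤ ((k + 1 : ℕ) : ℝ) / n * g 1 :=
      mul_le_mul_of_nonneg_right (by rw [le_div_iff₀ hn']; push_cast; exact hk2.le) hg1
    have E : ((k + 1 : ℕ) : ℝ) / n * g 1 = (k : ℝ) / n * g 1 + g 1 / n := by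
      push_cast; field_simp
    rw [abs_le]; constructor <;> linarith
  have hlim : Filter.Tendsto (fun n : ℕ => g 1 / (n : ℝ)) Filter.atTop (nhds 0) :=
    tendsto_const_div_atTop_nhds_zero_nat _
  have : |g t - t * g 1| ≤ 0 := ge_of_tendsto hlim (by
    filter_upwards [Filter.eventually_gt_atTop 0] with n hn using hbound n hn)
  exact sub_eq_zero.mp (abs_nonpos_iff.mp this)

theorem aux_proj_effect {H : Type*} [NormedAddCommGroup H] [InnerProductSpace ℂ H]
    [CompleteSpace H] (P : H →L[ℂ] H) (h : IsSelfAdjoint P) (hp : P * P = P) :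
    0 ≤ P ∧ P ≤ 1 := by
  have hpos : ∀ P : H →L[ℂ] H, IsSelfAdjoint P → P * P = P → 0 ≤ P := by
    intro P h hp
    have := star_mul_self_nonneg P
    rwa [h.star_eq, hp] at this
  refine ⟨hpos P h hp, ?_⟩
  have := hpos (1 - P) ((IsSelfAdjoint.one _).sub h) (by
    rw [sub_mul, mul_sub, mul_sub, hp]; simp)
  exact sub_nonneg.mp this


/-- If `dim H ≥ 3`, a bijective Jordan triple multiplicative map of the Hilbert space effect
algebra `[0, I]` is homogeneous on scalar multiples of rank-one projections:
`φ(λ P) = λ φ(P)` for all `λ ∈ [0, 1]` and rank-one projections `P`. -/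
theorem jordan_triple_bijection_of_effects_homogeneous_on_rank_one
    {H : Type*} [NormedAddCommGroup H] [InnerProductSpace ℂ H] [CompleteSpace H]
    (hdim : 3 ≤ Module.rank ℂ H)
    (φ : (H →L[ℂ] H) → (H →L[ℂ] H))
    (hbij : Set.BijOn φ {A : H →L[ℂ] H | 0 ≤ A ∧ A ≤ 1} {A : H →L[ℂ] H | 0 ≤ A ∧ A ≤ 1})
    (htriple : ∀ A : H →L[ℂ] H, 0 ≤ A → A ≤ 1 → ∀ B : H →L[ℂ] H, 0 ≤ B → B ≤ 1 →
      φ (A * B * A) = φ A * φ B * φ A) :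
    ∀ t : ℝ, t ∈ Set.Icc (0 : ℝ) 1 → ∀ P : H →L[ℂ] H, IsSelfAdjoint P → P * P = P →
      Module.finrank ℂ (LinearMap.range (P : H →ₗ[ℂ] H)) = 1 →
      φ ((t : ℂ) • P) = (t : ℂ) • φ P := by
  have hmaps := hbij.mapsTo
  have hinj := hbij.injOn
  have hsurj := hbij.surjOn
  have e0 : (0 : H →L[ℂ] H) ∈ {A : H →L[ℂ] H | 0 ≤ A ∧ A ≤ 1} := ⟨le_rfl, zero_le_one⟩
  have e1 : (1 : H →L[ℂ] H) ∈ {A : H →L[ℂ] H | 0 ≤ A ∧ A ≤ 1} := ⟨zero_le_one, le_rfl⟩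
  have φ0 : φ 0 = 0 := by
    obtain ⟨A, hA, hA0⟩ := hsurj e0
    have := htriple A hA.1 hA.2 0 e0.1 e0.2
    simpa [hA0] using this
  have φ1 : φ 1 = 1 := by
    obtain ⟨A, hA, hA1⟩ := hsurj e1
    have h := htriple 1 e1.1 e1.2 A hA.1 hA.2
    rw [one_mul, mul_one, hA1, mul_one] at h
    have hp := hmaps e1
    have h3 : 0 ≤ φ 1 * (1 - φ 1) := Commute.mul_nonneg hp.1 (sub_nonneg.mpr hp.2)
      ((Commute.one_right _).sub_right (Commute.refl _))
    rw [mul_sub, mul_one, ← h] at h3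
    exact le_antisymm hp.2 (sub_nonneg.mp h3)
  have φsq : ∀ A : H →L[ℂ] H, 0 ≤ A → A ≤ 1 → φ (A * A) = φ A * φ A := by
    intro A h h'
    have := htriple A h h' 1 e1.1 e1.2
    rwa [mul_one, φ1, mul_one] at this
  intro t ht Q hQ hQQ hr
  have eQ := aux_proj_effect Q hQ hQQ
  have etQ : ∀ s : ℝ, 0 ≤ s → s ≤ 1 → 0 ≤ (s : ℂ) • Q ∧ (s : ℂ) • Q ≤ 1 := by
    intro s hs hs'
    have A : 0 ≤ s • Q := smul_nonneg hs eQ.1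
    have B : 0 ≤ (1 - s) • Q := smul_nonneg (by linarith) eQ.1
    have hc : (s : ℂ) • Q = s • Q := by ext z; simp
    rw [hc]
    refine ⟨A, le_trans ?_ eQ.2⟩
    rw [sub_smul, one_smul] at B
    exact sub_nonneg.mp B
  have key : ∀ s : ℝ, 0 ≤ s → s ≤ 1 →
      φ ((s : ℂ) • Q) + φ (((1 - s : ℝ) : ℂ) • Q) = φ Q := by
    intro s hs hs'
    obtain ⟨P₁, P₂, a₁, a₂, p₁, p₂, p12, hsum, hq1, hq2⟩ :=
      aux_exists_decomp hdim Q hQ hQQ hr s hs hs'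
    have f₁ := aux_proj_effect P₁ a₁ p₁
    have f₂ := aux_proj_effect P₂ a₂ p₂
    have g₁ := hmaps f₁
    have g₂ := hmaps f₂
    have b₁ : IsSelfAdjoint (φ P₁) := IsSelfAdjoint.of_nonneg g₁.1
    have b₂ : IsSelfAdjoint (φ P₂) := IsSelfAdjoint.of_nonneg g₂.1
    have q₁ : φ P₁ * φ P₁ = φ P₁ := by rw [← φsq _ f₁.1 f₁.2, p₁]
    have q₂ : φ P₂ * φ P₂ = φ P₂ := by rw [← φsq _ f₂.1 f₂.2, p₂]
    have z21 : φ P₂ * φ P₁ = 0 := by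
      have h := htriple P₁ f₁.1 f₁.2 P₂ f₂.1 f₂.2
      rw [p12, zero_mul, φ0] at h
      rw [← CStarRing.star_mul_self_eq_zero_iff, star_mul, b₁.star_eq, b₂.star_eq]
      calc φ P₁ * φ P₂ * (φ P₂ * φ P₁) = φ P₁ * (φ P₂ * φ P₂) * φ P₁ := by noncomm_ring
        _ = 0 := by rw [q₂, ← h]
    have z12 : φ P₁ * φ P₂ = 0 := by
      have := congrArg star z21
      rwa [star_mul, b₁.star_eq, b₂.star_eq, star_zero] at this
    have hSS : (φ P₁ + φ P₂) * (φ P₁ + φ P₂) = φ P₁ + φ P₂ := by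
      rw [add_mul, mul_add, mul_add, q₁, q₂, z12, z21]; simp
    obtain ⟨T, hT, hTS⟩ := hsurj (aux_proj_effect _ (b₁.add b₂) hSS)
    have hTsa : IsSelfAdjoint T := IsSelfAdjoint.of_nonneg hT.1
    -- conjugation keeps us inside the effects
    have conj : ∀ A B : H →L[ℂ] H, (0 ≤ A ∧ A ≤ 1) → (0 ≤ B ∧ B ≤ 1) →
        0 ≤ A * B * A ∧ A * B * A ≤ 1 := by
      intro A B hA hB
      have hs : IsSelfAdjoint A := IsSelfAdjoint.of_nonneg hA.1
      have h1 := hs.conjugate_nonneg hB.1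
      have h2 := hs.conjugate_nonneg (sub_nonneg.mpr hB.2)
      refine ⟨h1, ?_⟩
      have h3 : A * B * A ≤ A * A := by
        rw [mul_sub, sub_mul, mul_one] at h2
        exact sub_nonneg.mp h2
      refine h3.trans ?_
      have h4 : A * A ≤ A := by
        have : 0 ≤ A * (1 - A) := Commute.mul_nonneg hA.1 (sub_nonneg.mpr hA.2)
          ((Commute.one_right A).sub_right (Commute.refl A))
        rw [mul_sub, mul_one] at this
        exact sub_nonneg.mp this
      exact h4.trans hA.2
    have hTT : T * T = T := by
      have hm := conj T 1 hT e1
      rw [mul_one] at hm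
      refine hinj hm hT ?_
      rw [φsq _ hT.1 hT.2, hTS, hSS]
    have t₁ : T * P₁ * T = P₁ := by
      refine hinj (conj T P₁ hT f₁) f₁ ?_
      rw [htriple T hT.1 hT.2 P₁ f₁.1 f₁.2, hTS, add_mul, q₁, z21, add_zero, mul_add, q₁, z12,
        add_zero]
    have t₂ : T * P₂ * T = P₂ := by
      refine hinj (conj T P₂ hT f₂) f₂ ?_
      rw [htriple T hT.1 hT.2 P₂ f₂.1 f₂.2, hTS, add_mul, q₂, z12, zero_add, mul_add, q₂, z21,
        zero_add]
    have u₁ : T * P₁ = P₁ := by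
      rw [← t₁, ← mul_assoc, ← mul_assoc, hTT]
    have u₂ : T * P₂ = P₂ := by
      rw [← t₂, ← mul_assoc, ← mul_assoc, hTT]
    have uQ : T * Q = Q := by
      rw [← hsum, ← mul_assoc, mul_add, u₁, u₂]
    have hQTQ : Q * T * Q = Q := by rw [mul_assoc, uQ, hQQ]
    have h := htriple Q eQ.1 eQ.2 T hT.1 hT.2
    rw [hQTQ, hTS, mul_add, add_mul, ← htriple Q eQ.1 eQ.2 P₁ f₁.1 f₁.2,
      ← htriple Q eQ.1 eQ.2 P₂ f₂.1 f₂.2, hq1, hq2] at h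
    exact h.symm
  have hmulF : ∀ c s : ℝ, 0 ≤ c → c ≤ 1 → 0 ≤ s → s ≤ 1 →
      φ (((c * s : ℝ) : ℂ) • Q) = φ ((√c : ℂ) • Q) * φ ((s : ℂ) • Q) * φ ((√c : ℂ) • Q) := by
    intro c s hc hc' hs hs'
    have hr1 : √c ≤ 1 := Real.sqrt_le_one.mpr hc'
    have hE := etQ _ (Real.sqrt_nonneg c) hr1
    rw [← htriple _ hE.1 hE.2 _ (etQ s hs hs').1 (etQ s hs hs').2]
    congr 1
    have hcc : (√c : ℂ) * (√c : ℂ) = c := by exact_mod_cast Real.mul_self_sqrt hc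
    rw [smul_mul_smul_comm, smul_mul_smul_comm, hQQ, hQQ]
    congr 1
    push_cast
    linear_combination -(s : ℂ) * hcc
  have haddF : ∀ a b : ℝ, 0 ≤ a → 0 ≤ b → a + b ≤ 1 →
      φ (((a + b : ℝ) : ℂ) • Q) = φ ((a : ℂ) • Q) + φ ((b : ℂ) • Q) := by
    intro a b ha hb hab
    rcases eq_or_lt_of_le (add_nonneg ha hb) with h0 | hpos
    · have ha0 : a = 0 := by linarith
      have hb0 : b = 0 := by linarith
      subst ha0 hb0; simp [φ0]
    · have hs0 : 0 ≤ a / (a + b) := by positivity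
      have hs1 : a / (a + b) ≤ 1 := by rw [div_le_one hpos]; linarith
      have k := key _ hs0 hs1
      have m1 := hmulF (a + b) (a / (a + b)) hpos.le hab hs0 hs1
      have m2 := hmulF (a + b) (1 - a / (a + b)) hpos.le hab (by linarith) (by linarith)
      have m3 := hmulF (a + b) 1 hpos.le hab zero_le_one le_rfl
      have r1 : (a + b) * (a / (a + b)) = a := by field_simp
      have r2 : (a + b) * (1 - a / (a + b)) = b := by field_simp; ring
      rw [r1] at m1
      rw [r2] at m2
      rw [mul_one] at m3
      rw [m1, m2, m3, ← add_mul, ← mul_add, k, Complex.ofReal_one, one_smul]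
  rw [← sub_eq_zero]
  have hfin : ∀ z : H, inner ℂ (φ ((t : ℂ) • Q) z) z = inner ℂ (((t : ℂ) • φ Q) z) z := by
    intro z
    have hnn : ∀ s : ℝ, 0 ≤ s → s ≤ 1 → (φ ((s : ℂ) • Q)).IsPositive := fun s h h' =>
      (ContinuousLinearMap.nonneg_iff_isPositive _).mp (hmaps (etQ s h h')).1
    have hl := aux_additive (fun s => (inner ℂ (φ ((s : ℂ) • Q) z) z).re)
      (fun s h h' => (hnn s h h').re_inner_nonneg_left z)
      (fun a b ha hb hab => by
        simp only [haddF a b ha hb hab, add_apply, inner_add_left,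
          Complex.add_re]) t ht.1 ht.2
    simp only [Complex.ofReal_one, one_smul] at hl
    have hreal : ∀ s : ℝ, 0 ≤ s → s ≤ 1 → (inner ℂ (φ ((s : ℂ) • Q) z) z).im = 0 := by
      intro s h h'
      have := (hnn s h h').inner_nonneg_left z
      exact (Complex.nonneg_iff.mp this).2.symm
    have h1 := hreal 1 zero_le_one le_rfl
    simp only [Complex.ofReal_one, one_smul] at h1
    apply Complex.ext
    · rw [hl]; simp [inner_smul_left]
    · rw [hreal t ht.1 ht.2]; simp [inner_smul_left, h1]
  have := (inner_map_self_eq_zero (V := H)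
    ((φ ((t : ℂ) • Q) - (t : ℂ) • φ Q : H →L[ℂ] H) : H →ₗ[ℂ] H)).mp (fun z => by
      simp only [ContinuousLinearMap.coe_coe, sub_apply, inner_sub_left,
        hfin z, sub_self])
  ext z
  exact congrArg (fun L : H →ₗ[ℂ] H => L z) this
end
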